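/- Let q be a real number with 0 < q < 1 and let a < 0. For every natural number n, the Jackson q-integral of x^n against the Al-Salam–Carlitz I weight satisfies ∫_a^1 x^n (qx;q)_∞ (a^{-1}qx;q)_∞ d_q x = (1-q) (q;q)_∞ (a;q)_∞ (a^{-1}q;q)_∞ · ∑_{i=0}^{n} C_q(n,i) a^i. -/

import Mathlib

open scoped BigOperators

/-- The finite q-Pochhammer symbol `(a;q)_n = ∏_{k=0}^{n-1} (1 - a q^k)`. -/
noncomputable def qPoch (a q : ℝ) (n : ℕ) : ℝ := ∏ k ∈ Finset.range n, (1 - a * q ^ k)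

/-- The infinite q-Pochhammer symbol `(a;q)_∞ = ∏_{k=0}^{∞} (1 - a q^k)`. -/
noncomputable def qPochInf (a q : ℝ) : ℝ := ∏' k : ℕ, (1 - a * q ^ k)

/-- The q-binomial coefficient `C_q(n,k) = (q;q)_n / ((q;q)_k (q;q)_{n-k})`. -/
noncomputable def qBinom (q : ℝ) (n k : ℕ) : ℝ :=
  qPoch q q n / (qPoch q q k * qPoch q q (n - k))

open Filter Topology Finset

section QPochhammer

variable {q : ℝ}

lemma summable_norm_neg_mul_pow (hq0 : 0 < q) (hq1 : q < 1) (x : ℝ) :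
    Summable fun k : ℕ => ‖-(x * q ^ k)‖ := by
  simp only [norm_neg]
  exact ((summable_geometric_of_lt_one hq0.le hq1).mul_left x).norm

lemma multipliable_qPochInf (hq0 : 0 < q) (hq1 : q < 1) (x : ℝ) :
    Multipliable fun k : ℕ => 1 - x * q ^ k := by
  simpa only [sub_eq_add_neg] using
    multipliable_one_add_of_summable (summable_norm_neg_mul_pow hq0 hq1 x)

lemma tendsto_qPoch (hq0 : 0 < q) (hq1 : q < 1) (x : ℝ) :
    Tendsto (qPoch x q) atTop (𝓝 (qPochInf x q)) :=
  (multipliable_qPochInf hq0 hq1 x).tendsto_prod_tprod_nat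

lemma one_sub_mul_pow_pos (hq0 : 0 < q) (hq1 : q < 1) {x : ℝ} (hx : x < 1) (k : ℕ) :
    0 < 1 - x * q ^ k := by
  have h1 : q ^ k ≤ 1 := pow_le_one₀ hq0.le hq1.le
  have h0 : 0 < q ^ k := pow_pos hq0 k
  nlinarith

lemma qPoch_pos (hq0 : 0 < q) (hq1 : q < 1) {x : ℝ} (hx : x < 1) (n : ℕ) : 0 < qPoch x q n :=
  prod_pos fun k _ => one_sub_mul_pow_pos hq0 hq1 hx k

lemma qPoch_succ (x q : ℝ) (n : ℕ) : qPoch x q (n + 1) = qPoch x q n * (1 - x * q ^ n) :=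
  prod_range_succ _ _

lemma qPochInf_ne_zero (hq0 : 0 < q) (hq1 : q < 1) {x : ℝ} (hx : x < 1) : qPochInf x q ≠ 0 := by
  have h := tprod_one_add_ne_zero_of_summable (f := fun k : ℕ => -(x * q ^ k))
    (fun k => by
      have := one_sub_mul_pow_pos hq0 hq1 hx k
      rw [← sub_eq_add_neg]
      exact this.ne') (summable_norm_neg_mul_pow hq0 hq1 x)
  simpa only [qPochInf, sub_eq_add_neg] using h

lemma qPoch_mul_qPochInf (hq0 : 0 < q) (hq1 : q < 1) (x : ℝ) (n : ℕ) :
    qPoch x q n * qPochInf (x * q ^ n) q = qPochInf x q := by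
  have h := (multipliable_qPochInf hq0 hq1 (x * q ^ n)).congr
    (g := fun k : ℕ => 1 - x * q ^ (k + n)) (fun k => by ring)
  have h2 := Multipliable.prod_mul_tprod_nat_mul' (f := fun k : ℕ => 1 - x * q ^ k) (k := n) h
  rw [qPoch, qPochInf, qPochInf, ← h2]
  congr 1
  exact tprod_congr fun k => by ring

lemma qPochInf_eq_one_sub_mul (hq0 : 0 < q) (hq1 : q < 1) (x : ℝ) :
    qPochInf x q = (1 - x) * qPochInf (x * q) q := by
  simpa [qPoch] using (qPoch_mul_qPochInf hq0 hq1 x 1).symm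

lemma tendsto_qPochInf_mul_pow (hq0 : 0 < q) (hq1 : q < 1) {x : ℝ} (hx : x < 1) :
    Tendsto (fun n : ℕ => qPochInf (x * q ^ n) q) atTop (𝓝 1) := by
  have hne := qPochInf_ne_zero hq0 hq1 hx
  have h := (tendsto_const_nhds (x := qPochInf x q)).div (tendsto_qPoch hq0 hq1 x) hne
  rw [div_self hne] at h
  refine h.congr fun n => ?_
  rw [Pi.div_apply, ← qPoch_mul_qPochInf hq0 hq1 x n,
    mul_div_cancel_left₀ _ (qPoch_pos hq0 hq1 hx n).ne']

lemma tendsto_inv_qPoch_self (hq0 : 0 < q) (hq1 : q < 1) :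
    Tendsto (fun n => (qPoch q q n)⁻¹) atTop (𝓝 (qPochInf q q)⁻¹) :=
  (tendsto_qPoch hq0 hq1 q).inv₀ (qPochInf_ne_zero hq0 hq1 hq1)

lemma exists_inv_qPoch_self_le (hq0 : 0 < q) (hq1 : q < 1) :
    ∃ C : ℝ, ∀ n, (qPoch q q n)⁻¹ ≤ C := by
  obtain ⟨C, hC⟩ := (tendsto_inv_qPoch_self hq0 hq1).bddAbove_range
  exact ⟨C, fun n => hC ⟨n, rfl⟩⟩

lemma inv_qPoch_self_succ (hq0 : 0 < q) (hq1 : q < 1) (n : ℕ) :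
    (1 - q ^ (n + 1)) * (qPoch q q (n + 1))⁻¹ = (qPoch q q n)⁻¹ := by
  have h : 1 - q ^ (n + 1) ≠ 0 := (sub_pos.2 (pow_lt_one₀ hq0.le hq1 (by simp))).ne'
  rw [qPoch_succ, ← pow_succ', mul_inv]
  field_simp

end QPochhammer

section QExponential

variable {q : ℝ}

/-- Euler's `q`-exponential series `∑ b^i / (q;q)_i`. -/
noncomputable def qExpSeries (q b : ℝ) : ℝ := ∑' i : ℕ, b ^ i * (qPoch q q i)⁻¹

lemma norm_pow_mul_inv_qPoch_le (hq0 : 0 < q) (hq1 : q < 1) {C : ℝ}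
    (hC : ∀ n, (qPoch q q n)⁻¹ ≤ C) (b : ℝ) (i : ℕ) :
    ‖b ^ i * (qPoch q q i)⁻¹‖ ≤ |b| ^ i * C := by
  rw [norm_mul, norm_pow, Real.norm_eq_abs, Real.norm_eq_abs,
    abs_of_pos (inv_pos.2 (qPoch_pos hq0 hq1 hq1 i))]
  gcongr
  exact hC i

lemma summable_qExpSeries (hq0 : 0 < q) (hq1 : q < 1) {b : ℝ} (hb : |b| < 1) :
    Summable fun i : ℕ => b ^ i * (qPoch q q i)⁻¹ := by
  obtain ⟨C, hC⟩ := exists_inv_qPoch_self_le hq0 hq1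
  exact .of_norm_bounded ((summable_geometric_of_lt_one (abs_nonneg b) hb).mul_right C)
    (norm_pow_mul_inv_qPoch_le hq0 hq1 hC b)

lemma abs_mul_pow_le (hq0 : 0 < q) (hq1 : q < 1) (b : ℝ) (n : ℕ) : |b * q ^ n| ≤ |b| := by
  rw [abs_mul, abs_of_pos (pow_pos hq0 n)]
  exact mul_le_of_le_one_right (abs_nonneg b) (pow_le_one₀ hq0.le hq1.le)

lemma qExpSeries_mul_q (hq0 : 0 < q) (hq1 : q < 1) {b : ℝ} (hb : |b| < 1) :
    qExpSeries q (b * q) = (1 - b) * qExpSeries q b := by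
  have hs := summable_qExpSeries hq0 hq1 hb
  have hbq : |b * q| < 1 := by simpa using (abs_mul_pow_le hq0 hq1 b 1).trans_lt hb
  have hs' := summable_qExpSeries hq0 hq1 hbq
  have h : qExpSeries q b - qExpSeries q (b * q) = b * qExpSeries q b := by
    rw [qExpSeries, qExpSeries, ← hs.tsum_sub hs', (hs.sub hs').tsum_eq_zero_add, ← tsum_mul_left]
    simp only [pow_zero, sub_self, zero_add]
    refine tsum_congr fun i => ?_
    rw [← inv_qPoch_self_succ hq0 hq1 i]
    ring
  linarith

lemma qExpSeries_mul_pow (hq0 : 0 < q) (hq1 : q < 1) {b : ℝ} (hb : |b| < 1) (n : ℕ) :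
    qExpSeries q (b * q ^ n) = qPoch b q n * qExpSeries q b := by
  induction n with
  | zero => simp [qPoch]
  | succ n ih =>
    rw [pow_succ, ← mul_assoc, qExpSeries_mul_q hq0 hq1 ((abs_mul_pow_le hq0 hq1 b n).trans_lt hb),
      ih, qPoch_succ]
    ring

lemma tendsto_qExpSeries_mul_pow (hq0 : 0 < q) (hq1 : q < 1) {b : ℝ} (hb : |b| < 1) :
    Tendsto (fun n : ℕ => qExpSeries q (b * q ^ n)) atTop (𝓝 1) := by
  obtain ⟨C, hC⟩ := exists_inv_qPoch_self_le hq0 hq1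
  have hC0 : 0 ≤ C := (inv_pos.2 (qPoch_pos hq0 hq1 hq1 0)).le.trans (hC 0)
  have h := tendsto_tsum_of_dominated_convergence (𝓕 := atTop)
    (f := fun (n : ℕ) (i : ℕ) => (b * q ^ n) ^ i * (qPoch q q i)⁻¹)
    (g := fun i => (0 : ℝ) ^ i * (qPoch q q i)⁻¹) (bound := fun i => |b| ^ i * C)
    ((summable_geometric_of_lt_one (abs_nonneg b) hb).mul_right C)
    (fun i => by
      have h := (tendsto_pow_atTop_nhds_zero_of_lt_one hq0.le hq1).const_mul b
      rw [mul_zero] at h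
      exact (h.pow i).mul_const _)
    (Eventually.of_forall fun n i =>
      (norm_pow_mul_inv_qPoch_le hq0 hq1 hC _ i).trans
        (mul_le_mul_of_nonneg_right
          (pow_le_pow_left₀ (abs_nonneg _) (abs_mul_pow_le hq0 hq1 b n) i) hC0))
  have h0 : ∑' i : ℕ, (0 : ℝ) ^ i * (qPoch q q i)⁻¹ = 1 := by
    rw [tsum_eq_single 0 (fun i hi => by simp [hi])]
    simp [qPoch]
  rwa [h0] at h

/-- Euler's identity `(b;q)_∞ ∑ b^i / (q;q)_i = 1`. -/
lemma qPochInf_mul_qExpSeries (hq0 : 0 < q) (hq1 : q < 1) {b : ℝ} (hb : |b| < 1) :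
    qPochInf b q * qExpSeries q b = 1 :=
  tendsto_nhds_unique
    (((tendsto_qPoch hq0 hq1 b).mul_const _).congr fun n => (qExpSeries_mul_pow hq0 hq1 hb n).symm)
    (tendsto_qExpSeries_mul_pow hq0 hq1 hb)

end QExponential

section RogersSzego

variable {q : ℝ}

/-- The Rogers–Szegő polynomial of degree `n` divided by `(q;q)_n`. -/
noncomputable def normalizedRogersSzego (q b : ℝ) (n : ℕ) : ℝ :=
  ∑ p ∈ antidiagonal n, b ^ p.1 * (qPoch q q p.1)⁻¹ * (qPoch q q p.2)⁻¹

lemma sum_qBinom_mul_pow (q b : ℝ) (n : ℕ) :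
    ∑ i ∈ range (n + 1), qBinom q n i * b ^ i = qPoch q q n * normalizedRogersSzego q b n := by
  rw [normalizedRogersSzego, Finset.Nat.sum_antidiagonal_eq_sum_range_succ_mk, mul_sum]
  refine sum_congr rfl fun i _ => ?_
  rw [qBinom, div_eq_mul_inv, mul_inv]
  ring

lemma normalizedRogersSzego_sub (hq0 : 0 < q) (hq1 : q < 1) (b : ℝ) (n : ℕ) :
    normalizedRogersSzego q b (n + 1) - normalizedRogersSzego q (b * q) (n + 1) =
      b * normalizedRogersSzego q b n := by
  simp only [normalizedRogersSzego]
  rw [← sum_sub_distrib, Finset.Nat.sum_antidiagonal_succ, mul_sum]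
  simp only [pow_zero, sub_self, zero_add]
  refine sum_congr rfl fun p _ => ?_
  rw [← inv_qPoch_self_succ hq0 hq1 p.1]
  ring

lemma one_sub_pow_mul_normalizedRogersSzego (hq0 : 0 < q) (hq1 : q < 1) (b : ℝ) (n : ℕ) :
    (1 - q ^ (n + 1)) * normalizedRogersSzego q b (n + 1) =
      b * normalizedRogersSzego q b n + normalizedRogersSzego q (b * q) n := by
  have h : normalizedRogersSzego q (b * q) (n + 1) - q ^ (n + 1) * normalizedRogersSzego q b (n + 1)
      = normalizedRogersSzego q (b * q) n := by
    simp only [normalizedRogersSzego]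
    have hpow : ∀ p ∈ antidiagonal (n + 1),
        (b * q) ^ p.1 * (qPoch q q p.1)⁻¹ * (qPoch q q p.2)⁻¹ -
          q ^ (n + 1) * (b ^ p.1 * (qPoch q q p.1)⁻¹ * (qPoch q q p.2)⁻¹) =
        (b * q) ^ p.1 * (qPoch q q p.1)⁻¹ * ((1 - q ^ p.2) * (qPoch q q p.2)⁻¹) := by
      intro p hp
      rw [← mem_antidiagonal.1 hp]
      ring
    rw [mul_sum, ← sum_sub_distrib, sum_congr rfl hpow, Finset.Nat.sum_antidiagonal_succ']
    simp only [pow_zero, sub_self, zero_mul, mul_zero, zero_add]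
    exact sum_congr rfl fun p _ => by rw [inv_qPoch_self_succ hq0 hq1]
  linarith [normalizedRogersSzego_sub hq0 hq1 b n]

/-- The Rogers–Szegő polynomial `∑ C_q(n,i) b^i`. -/
noncomputable def rogersSzego (q b : ℝ) (n : ℕ) : ℝ := ∑ i ∈ range (n + 1), qBinom q n i * b ^ i

lemma rogersSzego_succ (hq0 : 0 < q) (hq1 : q < 1) (b : ℝ) (n : ℕ) :
    rogersSzego q b (n + 1) = b * rogersSzego q b n + rogersSzego q (b * q) n := by
  simp only [rogersSzego, sum_qBinom_mul_pow]
  rw [qPoch_succ, ← pow_succ', mul_assoc, one_sub_pow_mul_normalizedRogersSzego hq0 hq1]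
  ring

lemma rogersSzego_add_two (hq0 : 0 < q) (hq1 : q < 1) (b : ℝ) (n : ℕ) :
    rogersSzego q b (n + 2) =
      (1 + b) * rogersSzego q b (n + 1) - b * (1 - q ^ (n + 1)) * rogersSzego q b n := by
  rw [rogersSzego_succ hq0 hq1 b (n + 1)]
  simp only [rogersSzego, sum_qBinom_mul_pow]
  have h := normalizedRogersSzego_sub hq0 hq1 b n
  rw [qPoch_succ, ← pow_succ', sub_eq_iff_eq_add.1 h]
  ring

lemma rogersSzego_zero (q b : ℝ) : rogersSzego q b 0 = 1 := by
  simp [rogersSzego, qBinom, qPoch]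

lemma rogersSzego_one (hq0 : 0 < q) (hq1 : q < 1) (b : ℝ) : rogersSzego q b 1 = 1 + b := by
  rw [rogersSzego_succ hq0 hq1, rogersSzego_zero, rogersSzego_zero]
  ring

lemma tendsto_rogersSzego (hq0 : 0 < q) (hq1 : q < 1) {b : ℝ} (hb : |b| < 1) :
    Tendsto (rogersSzego q b) atTop (𝓝 (qPochInf b q)⁻¹) := by
  obtain ⟨C, hC⟩ := exists_inv_qPoch_self_le hq0 hq1
  have hC0 : 0 ≤ C := (inv_pos.2 (qPoch_pos hq0 hq1 hq1 0)).le.trans (hC 0)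
  have h := tendsto_tsum_of_dominated_convergence (𝓕 := atTop)
    (f := fun (n : ℕ) (i : ℕ) =>
      if i ∈ range (n + 1) then b ^ i * (qPoch q q i)⁻¹ * (qPoch q q (n - i))⁻¹ else 0)
    (g := fun i => b ^ i * (qPoch q q i)⁻¹ * (qPochInf q q)⁻¹)
    (bound := fun i => |b| ^ i * C * C)
    (((summable_geometric_of_lt_one (abs_nonneg b) hb).mul_right C).mul_right C)
    (fun i => by
      refine (((tendsto_inv_qPoch_self hq0 hq1).comp (tendsto_sub_atTop_nat i)).const_mul
        (b ^ i * (qPoch q q i)⁻¹)).congr' ?_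
      filter_upwards [eventually_ge_atTop i] with n hn
      rw [if_pos (by simp; omega)]
      rfl)
    (Eventually.of_forall fun n i => by
      split_ifs
      · rw [norm_mul]
        have h1 := norm_pow_mul_inv_qPoch_le hq0 hq1 hC b i
        have h2 : ‖(qPoch q q (n - i))⁻¹‖ ≤ C := by
          rw [Real.norm_of_nonneg (inv_pos.2 (qPoch_pos hq0 hq1 hq1 _)).le]
          exact hC _
        exact mul_le_mul h1 h2 (norm_nonneg _) (by positivity)
      · rw [norm_zero]
        positivity)
  have hlim := (tendsto_qPoch hq0 hq1 q).mul h
  rw [tsum_mul_right, mul_comm (tsum _), mul_inv_cancel_left₀ (qPochInf_ne_zero hq0 hq1 hq1)] at hlim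
  rw [inv_eq_of_mul_eq_one_right (qPochInf_mul_qExpSeries hq0 hq1 hb)]
  refine hlim.congr fun n => ?_
  rw [rogersSzego, sum_qBinom_mul_pow, normalizedRogersSzego,
    Finset.Nat.sum_antidiagonal_eq_sum_range_succ_mk, tsum_eq_sum (s := range (n + 1))]
  · congr 1
    exact sum_congr rfl fun i hi => if_pos hi
  · exact fun i hi => if_neg hi

end RogersSzego

section Moments

variable {q : ℝ}

/-- The weight `(qx;q)_∞ (bqx;q)_∞` at `x = q^s`. -/
noncomputable def asc1Weight (q b : ℝ) (s : ℕ) : ℝ :=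
  qPochInf (q * q ^ s) q * qPochInf (b * q * q ^ s) q

/-- The `n`-th moment of `asc1Weight` over the points `q^s`, without the factor `1 - q`. -/
noncomputable def asc1HalfMoment (q b : ℝ) (n : ℕ) : ℝ :=
  ∑' s : ℕ, (q ^ s) ^ (n + 1) * asc1Weight q b s

lemma asc1Weight_eq_mul_succ (hq0 : 0 < q) (hq1 : q < 1) (b : ℝ) (s : ℕ) :
    asc1Weight q b s =
      (1 - q ^ (s + 1)) * (1 - b * q ^ (s + 1)) * asc1Weight q b (s + 1) := by
  rw [asc1Weight, qPochInf_eq_one_sub_mul hq0 hq1 (q * q ^ s),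
    qPochInf_eq_one_sub_mul hq0 hq1 (b * q * q ^ s), asc1Weight]
  ring_nf

lemma tendsto_asc1Weight (hq0 : 0 < q) (hq1 : q < 1) {b : ℝ} (hb : b ≤ 0) :
    Tendsto (asc1Weight q b) atTop (𝓝 1) := by
  have hbq : b * q < 1 := by nlinarith
  simpa only [mul_one, asc1Weight] using! (tendsto_qPochInf_mul_pow hq0 hq1 hq1).mul (tendsto_qPochInf_mul_pow hq0 hq1 hbq)

lemma summable_asc1HalfMoment (hq0 : 0 < q) (hq1 : q < 1) {b : ℝ} (hb : b ≤ 0) (n : ℕ) :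
    Summable fun s : ℕ => (q ^ s) ^ (n + 1) * asc1Weight q b s := by
  refine Summable.mul_tendsto_const (c := 1) ?_ ?_
  · simp only [← pow_mul, mul_comm _ (n + 1)]
    simp only [pow_mul]
    exact (summable_geometric_of_lt_one (by positivity)
      (pow_lt_one₀ hq0.le hq1 n.succ_ne_zero)).norm
  · rw [Nat.cofinite_eq_atTop]
    exact tendsto_asc1Weight hq0 hq1 hb

lemma asc1HalfMoment_add_two (hq0 : 0 < q) (hq1 : q < 1) {b : ℝ} (hb : b ≤ 0) (n : ℕ) :
    b * asc1HalfMoment q b (n + 2) =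
      (1 + b) * asc1HalfMoment q b (n + 1) - (1 - q ^ (n + 1)) * asc1HalfMoment q b n := by
  have h0 := (summable_asc1HalfMoment hq0 hq1 hb n).hasSum
  have h1 := (summable_asc1HalfMoment hq0 hq1 hb (n + 1)).hasSum
  have h2 := (summable_asc1HalfMoment hq0 hq1 hb (n + 2)).hasSum
  have h := (h0.sub (h1.mul_left (1 + b))).add (h2.mul_left b)
  have h' := (hasSum_nat_add_iff' 1).2 h
  have hshift := h'.unique ((h0.mul_left (q ^ (n + 1))).congr_fun fun s => by
    rw [asc1Weight_eq_mul_succ hq0 hq1 b s]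
    ring)
  simp only [range_one, sum_singleton, pow_zero, one_pow] at hshift
  simp only [asc1HalfMoment]
  linear_combination hshift

lemma asc1HalfMoment_one (hq0 : 0 < q) (hq1 : q < 1) {b : ℝ} (hb : b ≤ 0) :
    b * asc1HalfMoment q b 1 = (1 + b) * asc1HalfMoment q b 0 - 1 := by
  have h0 := (summable_asc1HalfMoment hq0 hq1 hb 0).hasSum
  have h1 := (summable_asc1HalfMoment hq0 hq1 hb 1).hasSum
  have h := (hasSum_nat_add_iff' 1).2 ((h0.mul_left (1 + b)).sub (h1.mul_left b))
  have hpart : ∀ N, ∑ s ∈ range N, (asc1Weight q b (s + 1) - asc1Weight q b s) =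
      asc1Weight q b N - asc1Weight q b 0 := fun N => sum_range_sub _ N
  have hlim := h.tendsto_sum_nat
  have hsum : ∀ N, ∑ s ∈ range N, ((1 + b) * ((q ^ (s + 1)) ^ (0 + 1) * asc1Weight q b (s + 1)) -
      b * ((q ^ (s + 1)) ^ (1 + 1) * asc1Weight q b (s + 1))) =
      asc1Weight q b N - asc1Weight q b 0 := by
    intro N
    rw [← hpart]
    refine sum_congr rfl fun s _ => ?_
    rw [asc1Weight_eq_mul_succ hq0 hq1 b s]
    ring
  have huniq := tendsto_nhds_unique (hlim.congr hsum)
    ((tendsto_asc1Weight hq0 hq1 hb).sub_const _)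
  simp only [range_one, sum_singleton, pow_zero, one_pow] at huniq
  simp only [asc1HalfMoment]
  linear_combination -huniq

lemma tendsto_asc1HalfMoment (hq0 : 0 < q) (hq1 : q < 1) {b : ℝ} (hb : b ≤ 0) :
    Tendsto (asc1HalfMoment q b) atTop (𝓝 (asc1Weight q b 0)) := by
  have h := tendsto_tsum_of_dominated_convergence (𝓕 := atTop)
    (f := fun (n : ℕ) (s : ℕ) => (q ^ s) ^ (n + 1) * asc1Weight q b s)
    (g := fun s => if s = 0 then asc1Weight q b 0 else 0)
    (bound := fun s => ‖(q ^ s) ^ (0 + 1) * asc1Weight q b s‖)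
    (summable_asc1HalfMoment hq0 hq1 hb 0).norm
    (fun s => by
      rcases eq_or_ne s 0 with rfl | hs
      · simp
      · rw [if_neg hs]
        have h := ((tendsto_pow_atTop_nhds_zero_of_lt_one (r := q ^ s) (by positivity)
          (pow_lt_one₀ hq0.le hq1 hs)).comp (tendsto_add_atTop_nat 1)).mul_const (asc1Weight q b s)
        rwa [zero_mul] at h)
    (Eventually.of_forall fun n s => by
      rw [norm_mul, norm_mul, norm_pow (q ^ s) (n + 1), norm_pow (q ^ s) (0 + 1)]
      refine mul_le_mul_of_nonneg_right
        (pow_le_pow_of_le_one (norm_nonneg _) ?_ (Nat.add_le_add_right n.zero_le 1))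
        (norm_nonneg _)
      rw [Real.norm_of_nonneg (by positivity)]
      exact pow_le_one₀ hq0.le hq1.le)
  rwa [tsum_ite_eq] at h

/-- The `n`-th moment of the Al-Salam–Carlitz I weight, without the factor `1 - q`. -/
noncomputable def asc1Moment (q a : ℝ) (n : ℕ) : ℝ :=
  asc1HalfMoment q a⁻¹ n - a ^ (n + 1) * asc1HalfMoment q a n

lemma asc1Moment_eq_mul_rogersSzego (hq0 : 0 < q) (hq1 : q < 1) {a : ℝ} (ha : a < 0) (n : ℕ) :
    asc1Moment q a n = asc1Moment q a 0 * rogersSzego q a n := by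
  have hm : a * a⁻¹ = 1 := mul_inv_cancel₀ ha.ne
  have hinv : a⁻¹ ≤ 0 := (inv_lt_zero.2 ha).le
  induction n using Nat.twoStepInduction with
  | zero => rw [rogersSzego_zero, mul_one]
  | one =>
    rw [rogersSzego_one hq0 hq1]
    have h1 := asc1HalfMoment_one hq0 hq1 hinv
    have h2 := asc1HalfMoment_one hq0 hq1 ha.le
    simp only [asc1Moment]
    linear_combination a * h1 - a * h2 -
      (asc1HalfMoment q a⁻¹ 1 - asc1HalfMoment q a⁻¹ 0) * hm
  | more n ih0 ih1 =>
    rw [rogersSzego_add_two hq0 hq1]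
    have h1 := asc1HalfMoment_add_two hq0 hq1 hinv n
    have h2 := asc1HalfMoment_add_two hq0 hq1 ha.le n
    have hrec : asc1Moment q a (n + 2) =
        (1 + a) * asc1Moment q a (n + 1) - a * (1 - q ^ (n + 1)) * asc1Moment q a n := by
      simp only [asc1Moment]
      linear_combination a * h1 - a ^ (n + 2) * h2 -
        (asc1HalfMoment q a⁻¹ (n + 2) - asc1HalfMoment q a⁻¹ (n + 1)) * hm
    rw [hrec, ih0, ih1]
    ring

lemma asc1Moment_zero_of_neg_one_le (hq0 : 0 < q) (hq1 : q < 1) {a : ℝ} (ha : a < 0)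
    (ha1 : -1 ≤ a) :
    asc1Moment q a 0 = qPochInf q q * qPochInf a q * qPochInf (a⁻¹ * q) q := by
  have hm : a * a⁻¹ = 1 := mul_inv_cancel₀ ha.ne
  have hinv : a⁻¹ ≤ 0 := (inv_lt_zero.2 ha).le
  have haq : |a * q| < 1 := by
    rw [abs_lt]
    constructor <;> nlinarith
  have hne : qPochInf (a * q) q ≠ 0 := qPochInf_ne_zero hq0 hq1 (abs_lt.1 haq).2
  have h1 := tendsto_asc1HalfMoment hq0 hq1 hinv
  have h2 := tendsto_asc1HalfMoment hq0 hq1 ha.le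
  have hdiff : Tendsto (fun n => asc1HalfMoment q a n - asc1HalfMoment q a (n + 1)) atTop (𝓝 0) := by
    simpa using h2.sub (h2.comp (tendsto_add_atTop_nat 1))
  have hzero : Tendsto (fun n => a ^ (n + 1) *
      (asc1HalfMoment q a n - asc1HalfMoment q a (n + 1))) atTop (𝓝 0) := by
    refine squeeze_zero_norm (fun n => ?_) (tendsto_zero_iff_norm_tendsto_zero.1 hdiff)
    rw [norm_mul, norm_pow]
    refine mul_le_of_le_one_left (norm_nonneg _) (pow_le_one₀ (norm_nonneg _) ?_)
    rw [Real.norm_eq_abs, abs_le]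
    constructor <;> linarith
  have hlim := (h1.sub ((h1.comp (tendsto_add_atTop_nat 1)).const_mul a⁻¹)).sub hzero
  have hlim' := ((tendsto_rogersSzego hq0 hq1 haq).const_mul (asc1Moment q a 0 * -a⁻¹)).congr
    (f₂ := fun n => asc1HalfMoment q a⁻¹ n - a⁻¹ * asc1HalfMoment q a⁻¹ (n + 1) -
      a ^ (n + 1) * (asc1HalfMoment q a n - asc1HalfMoment q a (n + 1))) (fun n => by
      have e0 := asc1Moment_eq_mul_rogersSzego hq0 hq1 ha n
      have e1 := asc1Moment_eq_mul_rogersSzego hq0 hq1 ha (n + 1)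
      rw [rogersSzego_succ hq0 hq1] at e1
      rw [asc1Moment] at e0 e1
      linear_combination -e0 + a⁻¹ * e1 + (asc1Moment q a 0 * rogersSzego q a n +
        a ^ (n + 1) * asc1HalfMoment q a (n + 1)) * hm)
  have huniq := tendsto_nhds_unique hlim hlim'
  rw [asc1Weight, pow_zero, mul_one, mul_one] at huniq
  rw [qPochInf_eq_one_sub_mul hq0 hq1 a]
  have hP := mul_inv_cancel₀ hne
  linear_combination a * qPochInf (a * q) q * huniq +
    (qPochInf (a * q) q * (qPochInf q q * qPochInf (a⁻¹ * q) q) -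
      asc1Moment q a 0 * (qPochInf (a * q) q * (qPochInf (a * q) q)⁻¹)) * hm -
    asc1Moment q a 0 * hP

lemma asc1Moment_zero (hq0 : 0 < q) (hq1 : q < 1) {a : ℝ} (ha : a < 0) :
    asc1Moment q a 0 = qPochInf q q * qPochInf a q * qPochInf (a⁻¹ * q) q := by
  rcases le_total (-1) a with ha1 | ha1
  · exact asc1Moment_zero_of_neg_one_le hq0 hq1 ha ha1
  · have ha0 := ha.ne
    have hinv1 : -1 ≤ a⁻¹ := by
      rw [← inv_neg_one]
      exact (inv_le_inv_of_neg (by norm_num) ha).2 ha1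
    have h := asc1Moment_zero_of_neg_one_le hq0 hq1 (inv_lt_zero.2 ha) hinv1
    have hrefl : asc1Moment q a 0 = -a * asc1Moment q a⁻¹ 0 := by
      simp only [asc1Moment, inv_inv]
      linear_combination -asc1HalfMoment q a⁻¹ 0 * mul_inv_cancel₀ ha0
    rw [hrefl, h, inv_inv, qPochInf_eq_one_sub_mul hq0 hq1 a⁻¹, qPochInf_eq_one_sub_mul hq0 hq1 a]
    field_simp
    ring

end Moments

/-- Moments of the Al-Salam–Carlitz I weight: the Jackson q-integral
`∫_a^1 x^n (qx;q)_∞ (a⁻¹qx;q)_∞ d_q x = (1-q)(q;q)_∞(a;q)_∞(a⁻¹q;q)_∞ ∑_{i=0}^n C_q(n,i) a^i`,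
where the Jackson q-integral on `[a,1]` is `(1-q) ∑_{s=0}^∞ q^s (f(q^s) - a f(a q^s))`. -/
theorem alSalamCarlitzI_moments (q : ℝ) (hq0 : 0 < q) (hq1 : q < 1) (a : ℝ) (ha : a < 0) (n : ℕ) :
    (1 - q) * ∑' s : ℕ, q ^ s *
        ((q ^ s) ^ n * qPochInf (q * q ^ s) q * qPochInf (a⁻¹ * q * q ^ s) q -
          a * ((a * q ^ s) ^ n * qPochInf (q * (a * q ^ s)) q *
            qPochInf (a⁻¹ * q * (a * q ^ s)) q)) =
      (1 - q) * qPochInf q q * qPochInf a q * qPochInf (a⁻¹ * q) q *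
        ∑ i ∈ Finset.range (n + 1), qBinom q n i * a ^ i := by
  have hinv : a⁻¹ ≤ 0 := (inv_lt_zero.2 ha).le
  have hsum := (summable_asc1HalfMoment hq0 hq1 hinv n).hasSum.sub
    ((summable_asc1HalfMoment hq0 hq1 ha.le n).hasSum.mul_left (a ^ (n + 1)))
  have hmoment := asc1Moment_eq_mul_rogersSzego hq0 hq1 ha n
  rw [asc1Moment_zero hq0 hq1 ha, asc1Moment, asc1HalfMoment, asc1HalfMoment, ← hsum.tsum_eq,
    rogersSzego] at hmoment
  rw [mul_assoc (1 - q), mul_assoc (1 - q), mul_assoc (1 - q), ← hmoment]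
  congr 1
  refine tsum_congr fun s => ?_
  have e1 : q * (a * q ^ s) = a * q * q ^ s := by ring
  have e2 : a⁻¹ * q * (a * q ^ s) = q * q ^ s := by
    field_simp [ha.ne]
  rw [e1, e2, asc1Weight, asc1Weight]
  ring
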